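/- There exists a constant c such that for every formula φ of the logic K^#, there exists a GNN A with at most c·(md(φ)+1) layers satisfying ⟦φ⟧ = ⟦A⟧, where md(φ) is the modal depth of φ. -/

import Mathlib

/-- A labeled directed graph: finite vertex set, directed edges, and a
labeling of each vertex by a valuation over atomic propositions (ℕ). -/
structure PGraph where
  V : Type
  fintV : Fintype V
  decV : DecidableEq V
  E : V → V → Bool
  label : V → ℕ → Bool

attribute [instance] PGraph.fintV PGraph.decV

mutual
/-- Formulas of the logic K^#. -/
inductive KForm : Type where
  | atom : ℕ → KForm
  | neg : KForm → KForm
  | or : KForm → KForm → KForm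
  | geq : KExpr → KForm          -- ξ ≥ 0
/-- Arithmetic expressions of the logic K^#. -/
inductive KExpr : Type where
  | const : ℤ → KExpr
  | one : KForm → KExpr          -- 1_φ
  | count : KForm → KExpr        -- #φ
  | add : KExpr → KExpr → KExpr
  | mul : ℤ → KExpr → KExpr      -- c × ξ
end

mutual
/-- Truth of a K^# formula at a pointed graph. -/
def KForm.eval (G : PGraph) : G.V → KForm → Bool
  | u, .atom p => G.label u p
  | u, .neg φ => !(KForm.eval G u φ)
  | u, .or φ ψ => KForm.eval G u φ || KForm.eval G u ψ
  | u, .geq ξ => decide (0 ≤ KExpr.eval G u ξ)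
/-- Value of a K^# arithmetic expression at a pointed graph. -/
def KExpr.eval (G : PGraph) : G.V → KExpr → ℤ
  | _, .const c => c
  | u, .one φ => if KForm.eval G u φ then 1 else 0
  | u, .count φ =>
      ((Finset.univ.filter (fun v => G.E u v && KForm.eval G v φ = true)).card : ℤ)
  | u, .add ξ ξ' => KExpr.eval G u ξ + KExpr.eval G u ξ'
  | u, .mul c ξ => c * KExpr.eval G u ξ
end

def KForm.satisfiable (φ : KForm) : Prop := ∃ (G : PGraph) (u : G.V), φ.eval G u = true

def KForm.valid (φ : KForm) : Prop := ∀ (G : PGraph) (u : G.V), φ.eval G u = true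

/-- Truncated ReLU. -/
noncomputable def trunc (x : ℝ) : ℝ := max 0 (min 1 x)

/-- A GNN: `L` layers; layer `t` (for `0 ≤ t < L`) has integer matrices
`C t`, `A t` and integer bias `b t`, mapping states of dimension `dim t` to
states of dimension `dim (t+1)`; `a` gives the integer coefficients of the
final linear classification function. The initial dimension `dim 0` is the
number of atomic propositions used. -/
structure GNN where
  L : ℕ
  dim : ℕ → ℕ
  C : (t : ℕ) → Matrix (Fin (dim t)) (Fin (dim (t + 1))) ℤ
  A : (t : ℕ) → Matrix (Fin (dim t)) (Fin (dim (t + 1))) ℤ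
  b : (t : ℕ) → Fin (dim (t + 1)) → ℤ
  a : Fin (dim L) → ℤ

/-- The state of a GNN on a graph after `t` layers. -/
noncomputable def GNN.state (N : GNN) (G : PGraph) : (t : ℕ) → G.V → Fin (N.dim t) → ℝ
  | 0, u, i => if G.label u i then 1 else 0
  | t + 1, u, j => trunc (
      (∑ i, N.state G t u i * (N.C t i j : ℝ)) +
      (∑ i, (∑ v ∈ Finset.univ.filter (fun v => G.E u v = true), N.state G t v i)
            * (N.A t i j : ℝ)) +
      (N.b t j : ℝ))

/-- The GNN accepts a pointed graph iff `cls(x_L(u)) = 1`, i.e. `Σ a_i x_i ≥ 1`. -/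
noncomputable def GNN.accepts (N : GNN) (G : PGraph) (u : G.V) : Prop :=
  1 ≤ ∑ i, (N.a i : ℝ) * N.state G N.L u i

mutual
/-- Modal depth of a K^# formula. -/
def KForm.md : KForm → ℕ
  | .atom _ => 0
  | .neg φ => φ.md
  | .or φ ψ => max φ.md ψ.md
  | .geq ξ => ξ.md
/-- Modal depth of a K^# expression. -/
def KExpr.md : KExpr → ℕ
  | .const _ => 0
  | .one φ => φ.md
  | .count φ => φ.md + 1
  | .add ξ ξ' => max ξ.md ξ'.md
  | .mul _ ξ => ξ.md
end

mutual
/-- Size (number of syntax-tree nodes) of a K^# formula. -/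
def KForm.size : KForm → ℕ
  | .atom _ => 1
  | .neg φ => φ.size + 1
  | .or φ ψ => φ.size + ψ.size + 1
  | .geq ξ => ξ.size + 1
/-- Size (number of syntax-tree nodes) of a K^# expression. -/
def KExpr.size : KExpr → ℕ
  | .const _ => 1
  | .one φ => φ.size + 1
  | .count φ => φ.size + 1
  | .add ξ ξ' => ξ.size + ξ'.size + 1
  | .mul _ ξ => ξ.size + 2
end

mutual
/-- Atomic propositions occurring in a K^# formula. -/
def KForm.atoms : KForm → Finset ℕ
  | .atom p => {p}
  | .neg φ => φ.atoms
  | .or φ ψ => φ.atoms ∪ ψ.atoms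
  | .geq ξ => ξ.atoms
/-- Atomic propositions occurring in a K^# expression. -/
def KExpr.atoms : KExpr → Finset ℕ
  | .const _ => ∅
  | .one φ => φ.atoms
  | .count φ => φ.atoms
  | .add ξ ξ' => ξ.atoms ∪ ξ'.atoms
  | .mul _ ξ => ξ.atoms
end

/-- Conjunction, defined from ¬ and ∨. -/
def KForm.andF (φ ψ : KForm) : KForm := .neg (.or (.neg φ) (.neg ψ))

/-- Implication, defined from ¬ and ∨. -/
def KForm.impF (φ ψ : KForm) : KForm := .or (.neg φ) ψ

/-- Bi-implication, defined from ¬ and ∨. -/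
def KForm.iffF (φ ψ : KForm) : KForm := KForm.andF (φ.impF ψ) (ψ.impF φ)

/-- The modality □φ, abbreviating `0 − #(¬φ) ≥ 0`. -/
def KForm.box (φ : KForm) : KForm :=
  .geq (.add (.const 0) (.mul (-1) (.count (.neg φ))))

/-- `i`-fold iteration □^i of □. -/
def KForm.boxIter : ℕ → KForm → KForm
  | 0, φ => φ
  | i + 1, φ => KForm.box (KForm.boxIter i φ)

/-- The modality `□^{≤m} φ := ⋀_{0 ≤ i ≤ m} □^i φ`. -/
def KForm.boxUpTo : ℕ → KForm → KForm
  | 0, φ => φ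
  | m + 1, φ => KForm.andF (KForm.boxUpTo m φ) (KForm.boxIter (m + 1) φ)

/-- `#ψ = k`, abbreviating `(#ψ − k ≥ 0) ∧ (k − #ψ ≥ 0)`. -/
def KForm.countEq (ψ : KForm) (k : ℤ) : KForm :=
  KForm.andF (.geq (.add (.count ψ) (.const (-k))))
             (.geq (.add (.const k) (.mul (-1) (.count ψ))))

/-! ### Networks as sequences of layers with coordinates in `ℕ` -/

/-- A layer with coordinates in `ℕ`, reading the first `dim` coordinates of its input. -/
structure Layer where
  dim : ℕ
  C : ℕ → ℕ → ℤ
  A : ℕ → ℕ → ℤ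
  b : ℕ → ℤ

/-- The successors of a vertex. -/
def PGraph.succ (G : PGraph) (u : G.V) : Finset G.V :=
  Finset.univ.filter (fun v => G.E u v = true)

/-- The state after `t` layers of a sequence of layers. -/
noncomputable def Layer.run (s : ℕ → Layer) (G : PGraph) : ℕ → G.V → ℕ → ℝ
  | 0, u, i => if G.label u i then 1 else 0
  | t + 1, u, j => trunc (
      (∑ i ∈ Finset.range (s t).dim, Layer.run s G t u i * ((s t).C i j : ℝ)) +
      (∑ i ∈ Finset.range (s t).dim, (∑ v ∈ G.succ u, Layer.run s G t v i) * ((s t).A i j : ℝ)) +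
      ((s t).b j : ℝ))

/-- The GNN consisting of the first `L` layers of a sequence of layers. -/
def GNN.ofLayers (s : ℕ → Layer) (L : ℕ) (a : ℕ → ℤ) : GNN where
  L := L
  dim t := (s t).dim
  C t i j := (s t).C i j
  A t i j := (s t).A i j
  b t j := (s t).b j
  a i := a i

theorem GNN.state_ofLayers (s : ℕ → Layer) (L : ℕ) (a : ℕ → ℤ) (G : PGraph) (t : ℕ) :
    ∀ (u : G.V) (i : Fin (s t).dim),
      (GNN.ofLayers s L a).state G t u i = Layer.run s G t u i := by
  induction t with
  | zero => intro u i; rfl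
  | succ t ih =>
    intro u j
    simp only [GNN.state, Layer.run, Finset.sum_range]
    refine congrArg trunc (congrArg₂ _ (congrArg₂ _ ?_ ?_) rfl)
    · exact Finset.sum_congr rfl fun i _ => congrArg₂ _ (ih u i) rfl
    · exact Finset.sum_congr rfl fun i _ =>
        congrArg₂ _ (Finset.sum_congr rfl fun v _ => ih v i) rfl

theorem Layer.run_congr {s s' : ℕ → Layer} (G : PGraph) {t : ℕ} (h : ∀ r < t, s r = s' r) :
    Layer.run s G t = Layer.run s' G t := by
  induction t with
  | zero => rfl
  | succ t ih =>
    have ih' := ih fun r hr => h r (hr.trans t.lt_succ_self)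
    funext u j
    simp only [Layer.run, ih', h t t.lt_succ_self]

theorem trunc_intCast_add_one (z : ℤ) : trunc ((z : ℝ) + 1) = if 0 ≤ z then 1 else 0 := by
  unfold trunc
  split_ifs with h
  · have : (0 : ℝ) ≤ z := by exact_mod_cast h
    rw [min_eq_left (by linarith), max_eq_right zero_le_one]
  · have : (z : ℝ) + 1 ≤ 0 := by exact_mod_cast (by omega : z + 1 ≤ 0)
    rw [max_eq_left ((min_le_right _ _).trans this)]

/-! ### Families of Boolean properties computed by a network -/

/-- Some network has, after `n` layers, the truth values of the family `β` as its state. -/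
def Computes {ι : Type} (n : ℕ) (β : (G : PGraph) → G.V → ι → Bool) : Prop :=
  ∃ (s : ℕ → Layer) (d : ℕ) (e : ι ≃ Fin d), ∀ (G : PGraph) (u : G.V) (i : ι),
    Layer.run s G n u (e i) = if β G u i then 1 else 0

theorem computes_label (k : ℕ) :
    Computes 0 (fun (G : PGraph) (u : G.V) (i : Fin k) => G.label u i) :=
  ⟨fun _ => ⟨0, 0, 0, 0⟩, k, Equiv.refl _, fun _ _ _ => rfl⟩

/-- One layer evaluates integer threshold conditions. -/
theorem Computes.threshold {ι κ : Type} [Fintype ι] [Fintype κ] {n : ℕ}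
    {β : (G : PGraph) → G.V → ι → Bool} (hβ : Computes n β)
    (C A : ι → κ → ℤ) (b : κ → ℤ) (γ : (G : PGraph) → G.V → κ → Bool)
    (hγ : ∀ G u j, γ G u j = true ↔
      0 ≤ ∑ i, (if β G u i then C i j else 0) +
        ∑ v ∈ G.succ u, ∑ i, (if β G v i then A i j else 0) + b j) :
    Computes (n + 1) γ := by
  obtain ⟨s, d, e, hs⟩ := hβ
  let e' := Fintype.equivFin κ
  let lift (M : ι → κ → ℤ) (i j : ℕ) : ℤ :=
    if h : i < d ∧ j < Fintype.card κ then M (e.symm ⟨i, h.1⟩) (e'.symm ⟨j, h.2⟩) else 0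
  have hlift (M : ι → κ → ℤ) (i : ι) (j : κ) : lift M (e i) (e' j) = M i j := by
    simp [lift]
  let bias (j : ℕ) : ℤ := if h : j < Fintype.card κ then b (e'.symm ⟨j, h⟩) + 1 else 0
  have hbias (j : κ) : bias (e' j) = b j + 1 := by simp [bias]
  let l : Layer := ⟨d, lift C, lift A, bias⟩
  refine ⟨Function.update s n l, _, e', fun G u j => ?_⟩
  have hrun : Layer.run (Function.update s n l) G n = Layer.run s G n :=
    Layer.run_congr G fun r hr => Function.update_of_ne hr.ne _ _
  simp only [Layer.run, hrun, Function.update_self]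
  simp only [l, Finset.sum_range, ← e.sum_comp, hlift, hbias, hs]
  have key := trunc_intCast_add_one (∑ i, (if β G u i then C i j else 0) +
    ∑ v ∈ G.succ u, ∑ i, (if β G v i then A i j else 0) + b j)
  simp only [← hγ] at key
  rw [← key]
  rw [Finset.sum_comm (s := G.succ u)]
  push_cast
  simp only [Finset.sum_mul, ite_mul, one_mul, zero_mul, add_assoc]

/-- One layer computes the one-hot encoding of a tuple of Boolean properties. -/
theorem Computes.oneHot {ι : Type} [Fintype ι] [DecidableEq ι] {n : ℕ}
    {β : (G : PGraph) → G.V → ι → Bool} (hβ : Computes n β) :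
    Computes (n + 1) (fun G u (t : ι → Bool) => decide (β G u = t)) := by
  refine hβ.threshold (fun i t => if t i then 1 else -1) (fun _ _ => 0)
    (fun t => -∑ i, if t i then 1 else 0) _ fun G u t => ?_
  simp only [decide_eq_true_eq, ite_self, Finset.sum_const_zero, add_zero, ← sub_eq_add_neg,
    ← Finset.sum_sub_distrib]
  have hle (i : ι) : ((if β G u i then (if t i then 1 else -1) else 0) -
      (if t i then 1 else 0) : ℤ) ≤ 0 := by
    cases β G u i <;> cases t i <;> simp
  constructor
  · rintro rfl
    exact Finset.sum_nonneg fun i _ => by cases β G u i <;> simp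
  · intro h
    have h0 := (Finset.sum_eq_zero_iff_of_nonpos fun i _ => hle i).1
      (le_antisymm (Finset.sum_nonpos fun i _ => hle i) h)
    funext i
    have := h0 i (Finset.mem_univ i)
    revert this
    cases β G u i <;> cases t i <;> simp

/-! ### Eliminating nested indicators -/

mutual
/-- The atoms and the arguments of `#` which do not occur below another `#`. -/
def KForm.heads : KForm → List KForm
  | .atom p => [.atom p]
  | .neg φ => φ.heads
  | .or φ ψ => φ.heads ++ ψ.heads
  | .geq ξ => ξ.heads
/-- The atoms and the arguments of `#` which do not occur below another `#`. -/
def KExpr.heads : KExpr → List KForm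
  | .const _ => []
  | .one φ => φ.heads
  | .count φ => [φ]
  | .add ξ ξ' => ξ.heads ++ ξ'.heads
  | .mul _ ξ => ξ.heads
end

mutual
theorem KForm.heads_md (n : ℕ) : ∀ φ : KForm, φ.md ≤ n + 1 → ∀ ψ ∈ φ.heads, ψ.md ≤ n
  | .atom p => by simp [KForm.heads, KForm.md]
  | .neg φ => KForm.heads_md n φ
  | .or φ ψ => by
    have h₁ := KForm.heads_md n φ
    have h₂ := KForm.heads_md n ψ
    simp only [KForm.heads, KForm.md, List.mem_append, max_le_iff]
    rintro ⟨h, h'⟩ χ (hχ | hχ)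
    exacts [h₁ h χ hχ, h₂ h' χ hχ]
  | .geq ξ => KExpr.heads_md n ξ
theorem KExpr.heads_md (n : ℕ) : ∀ ξ : KExpr, ξ.md ≤ n + 1 → ∀ ψ ∈ ξ.heads, ψ.md ≤ n
  | .const c => by simp [KExpr.heads]
  | .one φ => KForm.heads_md n φ
  | .count φ => by simp [KExpr.heads, KExpr.md]
  | .add ξ ξ' => by
    have h₁ := KExpr.heads_md n ξ
    have h₂ := KExpr.heads_md n ξ'
    simp only [KExpr.heads, KExpr.md, List.mem_append, max_le_iff]
    rintro ⟨h, h'⟩ χ (hχ | hχ)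
    exacts [h₁ h χ hχ, h₂ h' χ hχ]
  | .mul _ ξ => KExpr.heads_md n ξ
end

mutual
theorem KForm.heads_of_md_eq_zero :
    ∀ φ : KForm, φ.md = 0 → ∀ ψ ∈ φ.heads, ∃ p, ψ = .atom p
  | .atom p => by simp [KForm.heads]
  | .neg φ => KForm.heads_of_md_eq_zero φ
  | .or φ ψ => by
    have h₁ := KForm.heads_of_md_eq_zero φ
    have h₂ := KForm.heads_of_md_eq_zero ψ
    simp only [KForm.heads, KForm.md, List.mem_append, Nat.max_eq_zero_iff]
    rintro ⟨h, h'⟩ χ (hχ | hχ)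
    exacts [h₁ h χ hχ, h₂ h' χ hχ]
  | .geq ξ => KExpr.heads_of_md_eq_zero ξ
theorem KExpr.heads_of_md_eq_zero :
    ∀ ξ : KExpr, ξ.md = 0 → ∀ ψ ∈ ξ.heads, ∃ p, ψ = .atom p
  | .const c => by simp [KExpr.heads]
  | .one φ => KForm.heads_of_md_eq_zero φ
  | .count φ => by simp [KExpr.md]
  | .add ξ ξ' => by
    have h₁ := KExpr.heads_of_md_eq_zero ξ
    have h₂ := KExpr.heads_of_md_eq_zero ξ'
    simp only [KExpr.heads, KExpr.md, List.mem_append, Nat.max_eq_zero_iff]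
    rintro ⟨h, h'⟩ χ (hχ | hχ)
    exacts [h₁ h χ hχ, h₂ h' χ hχ]
  | .mul _ ξ => KExpr.heads_of_md_eq_zero ξ
end

/-- The truth value of `φ` at a pointed graph depends only on its type under `τ`. -/
def Determines {T : Type} (τ : (G : PGraph) → G.V → T) (φ : KForm) : Prop :=
  ∃ f : T → Bool, ∀ (G : PGraph) (u : G.V), φ.eval G u = f (τ G u)

theorem determines_of_forall {T : Type} {τ : (G : PGraph) → G.V → T} {φ : KForm}
    (h : ∀ (G : PGraph) (u : G.V) (G' : PGraph) (u' : G'.V), τ G u = τ G' u' →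
      φ.eval G u = φ.eval G' u') : Determines τ φ := by
  classical
  refine ⟨fun t => decide (∃ (G : PGraph) (u : G.V), τ G u = t ∧ φ.eval G u = true),
    fun G u => ?_⟩
  rw [Bool.eq_iff_iff, decide_eq_true_eq]
  refine ⟨fun hφ => ⟨G, u, rfl, hφ⟩, ?_⟩
  rintro ⟨G', u', ht, hφ⟩
  have heval := h G' u' G u ht
  rw [← hφ, heval]

/-- The value at `u` of the linear form with weight `m.1 (τ u)` at `u` itself and weight
`m.2 (τ v)` at each successor `v` of `u`. -/
def linVal {T : Type} (τ : (G : PGraph) → G.V → T) (m : (T → ℤ) × (T → ℤ))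
    (G : PGraph) (u : G.V) : ℤ :=
  m.1 (τ G u) + ∑ v ∈ G.succ u, m.2 (τ G v)

/-- Two pointed graphs satisfy the same threshold conditions from `Λ`. -/
def Agree {T : Type} (τ : (G : PGraph) → G.V → T) (Λ : List ((T → ℤ) × (T → ℤ)))
    (G : PGraph) (u : G.V) (G' : PGraph) (u' : G'.V) : Prop :=
  ∀ m ∈ Λ, (0 ≤ linVal τ m G u ↔ 0 ≤ linVal τ m G' u')

theorem agree_append {T : Type} {τ : (G : PGraph) → G.V → T} {Λ Λ' : List ((T → ℤ) × (T → ℤ))}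
    {G : PGraph} {u : G.V} {G' : PGraph} {u' : G'.V} :
    Agree τ (Λ ++ Λ') G u G' u' ↔ Agree τ Λ G u G' u' ∧ Agree τ Λ' G u G' u' :=
  List.forall_mem_append

mutual
/-- A formula is a Boolean combination of threshold conditions on the types of the successors. -/
theorem KForm.exists_thresholds {T : Type} {τ : (G : PGraph) → G.V → T} :
    ∀ φ : KForm, (∀ ψ ∈ φ.heads, Determines τ ψ) →
      ∃ Λ : List ((T → ℤ) × (T → ℤ)), ∀ G u G' u', Agree τ Λ G u G' u' →
        φ.eval G u = φ.eval G' u'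
  | .atom p => fun h => by
    obtain ⟨f, hf⟩ := h (.atom p) (by simp [KForm.heads])
    refine ⟨[(fun t => if f t then 0 else -1, 0)], fun G u G' u' hΛ => ?_⟩
    have := hΛ _ (List.mem_singleton.2 rfl)
    rw [hf, hf]
    revert this
    cases hx : f (τ G u) <;> cases hy : f (τ G' u') <;> simp [linVal, hx, hy]
  | .neg φ => fun h => by
    obtain ⟨Λ, hΛ⟩ := KForm.exists_thresholds φ h
    exact ⟨Λ, fun G u G' u' hA => by simp only [KForm.eval, hΛ G u G' u' hA]⟩
  | .or φ ψ => fun h => by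
    obtain ⟨Λ, hΛ⟩ := KForm.exists_thresholds φ fun χ hχ => h χ (List.mem_append_left _ hχ)
    obtain ⟨Λ', hΛ'⟩ := KForm.exists_thresholds ψ fun χ hχ => h χ (List.mem_append_right _ hχ)
    refine ⟨Λ ++ Λ', fun G u G' u' hA => ?_⟩
    obtain ⟨h₁, h₂⟩ := agree_append.1 hA
    simp only [KForm.eval, hΛ G u G' u' h₁, hΛ' G u G' u' h₂]
  | .geq ξ => fun h => by
    obtain ⟨Λ, M, hΛ⟩ := KExpr.exists_thresholds ξ h
    refine ⟨Λ ++ M, fun G u G' u' hA => ?_⟩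
    obtain ⟨h₁, h₂⟩ := agree_append.1 hA
    obtain ⟨m, hm, hu, hu'⟩ := hΛ G u G' u' h₁
    simp only [KForm.eval, hu, hu', h₂ m hm]
/-- An expression takes the value of one of finitely many linear forms, selected by finitely many
threshold conditions. -/
theorem KExpr.exists_thresholds {T : Type} {τ : (G : PGraph) → G.V → T} :
    ∀ ξ : KExpr, (∀ ψ ∈ ξ.heads, Determines τ ψ) →
      ∃ Λ M : List ((T → ℤ) × (T → ℤ)), ∀ G u G' u', Agree τ Λ G u G' u' →
        ∃ m ∈ M, ξ.eval G u = linVal τ m G u ∧ ξ.eval G' u' = linVal τ m G' u'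
  | .const c => fun _ =>
    ⟨[], [(fun _ => c, 0)], fun G u G' u' _ =>
      ⟨_, List.mem_singleton.2 rfl, by simp [KExpr.eval, linVal], by simp [KExpr.eval, linVal]⟩⟩
  | .one φ => fun h => by
    obtain ⟨Λ, hΛ⟩ := KForm.exists_thresholds φ h
    refine ⟨Λ, [(1, 0), (0, 0)], fun G u G' u' hA => ?_⟩
    have := hΛ G u G' u' hA
    cases hx : φ.eval G' u' <;> simp [KExpr.eval, linVal, this, hx]
  | .count φ => fun h => by
    obtain ⟨f, hf⟩ := h φ (by simp [KExpr.heads])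
    have key (G : PGraph) (u : G.V) : (KExpr.count φ).eval G u =
        linVal τ (0, fun t => if f t then 1 else 0) G u := by
      simp [KExpr.eval, linVal, hf, PGraph.succ, Finset.filter_filter]
    exact ⟨[], _, fun G u G' u' _ => ⟨_, List.mem_singleton.2 rfl, key G u, key G' u'⟩⟩
  | .add ξ ξ' => fun h => by
    obtain ⟨Λ, M, hΛ⟩ := KExpr.exists_thresholds ξ fun χ hχ => h χ (List.mem_append_left _ hχ)
    obtain ⟨Λ', M', hΛ'⟩ := KExpr.exists_thresholds ξ' fun χ hχ => h χ (List.mem_append_right _ hχ)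
    refine ⟨Λ ++ Λ', M.flatMap fun m => M'.map fun m' => m + m', fun G u G' u' hA => ?_⟩
    obtain ⟨h₁, h₂⟩ := agree_append.1 hA
    obtain ⟨m, hm, hu, hu'⟩ := hΛ G u G' u' h₁
    obtain ⟨m', hm', hv, hv'⟩ := hΛ' G u G' u' h₂
    refine ⟨m + m', List.mem_flatMap.2 ⟨m, hm, List.mem_map.2 ⟨m', hm', rfl⟩⟩, ?_, ?_⟩
    · simp only [KExpr.eval, hu, hv, linVal, Prod.fst_add, Prod.snd_add, Pi.add_apply,
        Finset.sum_add_distrib]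
      ring
    · simp only [KExpr.eval, hu', hv', linVal, Prod.fst_add, Prod.snd_add, Pi.add_apply,
        Finset.sum_add_distrib]
      ring
  | .mul c ξ => fun h => by
    obtain ⟨Λ, M, hΛ⟩ := KExpr.exists_thresholds ξ h
    refine ⟨Λ, M.map fun m => c • m, fun G u G' u' hA => ?_⟩
    obtain ⟨m, hm, hu, hu'⟩ := hΛ G u G' u' hA
    refine ⟨c • m, List.mem_map.2 ⟨m, hm, rfl⟩, ?_, ?_⟩
    · simp [KExpr.eval, hu, linVal, mul_add, Finset.mul_sum]
    · simp [KExpr.eval, hu', linVal, mul_add, Finset.mul_sum]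
end

/-! ### The translation -/

/-- Some network has, after `n` layers, as its state the one-hot encoding of a finite type
that determines every formula of `Φ`. -/
def TypesComputable (n : ℕ) (Φ : List KForm) : Prop :=
  ∃ (T : Type) (_ : Fintype T) (_ : DecidableEq T) (τ : (G : PGraph) → G.V → T),
    Computes n (fun G u t => decide (τ G u = t)) ∧ ∀ φ ∈ Φ, Determines τ φ

theorem typesComputable_atoms {Φ : List KForm} (h : ∀ φ ∈ Φ, ∃ p, φ = .atom p) :
    TypesComputable 1 Φ := by
  obtain ⟨k, hk⟩ : ∃ k, ∀ φ ∈ Φ, ∃ p < k, φ = .atom p := by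
    induction Φ with
    | nil => exact ⟨0, by simp⟩
    | cons φ Φ ih =>
      obtain ⟨k, hk⟩ := ih fun ψ hψ => h ψ (List.mem_cons_of_mem _ hψ)
      obtain ⟨p, rfl⟩ := h φ List.mem_cons_self
      refine ⟨max k (p + 1), List.forall_mem_cons.2 ⟨⟨p, by simp, rfl⟩, fun ψ hψ => ?_⟩⟩
      obtain ⟨q, hq, rfl⟩ := hk ψ hψ
      exact ⟨q, lt_max_of_lt_left hq, rfl⟩
  refine ⟨Fin k → Bool, inferInstance, inferInstance, _, (computes_label k).oneHot, ?_⟩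
  intro φ hφ
  obtain ⟨p, hp, rfl⟩ := hk φ hφ
  exact ⟨fun t => t ⟨p, hp⟩, fun G u => rfl⟩

theorem TypesComputable.of_heads {n : ℕ} {Φ : List KForm}
    (h : TypesComputable n (Φ.flatMap KForm.heads)) : TypesComputable (n + 2) Φ := by
  obtain ⟨T, _, _, τ, hτ, hdet⟩ := h
  obtain ⟨Λ, hΛ⟩ : ∃ Λ : List ((T → ℤ) × (T → ℤ)), ∀ φ ∈ Φ, ∀ G u G' u',
      Agree τ Λ G u G' u' → φ.eval G u = φ.eval G' u' := by
    clear hτ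
    induction Φ with
    | nil => exact ⟨[], by simp⟩
    | cons φ Φ ih =>
      simp only [List.flatMap_cons, List.forall_mem_append] at hdet
      obtain ⟨Λ, hΛ⟩ := φ.exists_thresholds hdet.1
      obtain ⟨Λ', hΛ'⟩ := ih hdet.2
      exact ⟨Λ ++ Λ', List.forall_mem_cons.2
        ⟨fun G u G' u' hA => hΛ G u G' u' (agree_append.1 hA).1,
          fun ψ hψ G u G' u' hA => hΛ' ψ hψ G u G' u' (agree_append.1 hA).2⟩⟩
  have hbits : Computes (n + 1) fun G u (j : Fin Λ.length) => decide (0 ≤ linVal τ Λ[j] G u) := by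
    refine hτ.threshold (fun t j => Λ[j].1 t) (fun t j => Λ[j].2 t) 0 _ fun G u j => ?_
    simp [linVal]
  refine ⟨Fin Λ.length → Bool, inferInstance, inferInstance, _, hbits.oneHot, fun φ hφ => ?_⟩
  refine determines_of_forall fun G u G' u' heq => hΛ φ hφ G u G' u' fun m hm => ?_
  obtain ⟨j, hj, rfl⟩ := List.mem_iff_getElem.1 hm
  simpa using congrFun heq ⟨j, hj⟩

theorem typesComputable_of_md_le (n : ℕ) :
    ∀ Φ : List KForm, (∀ φ ∈ Φ, φ.md ≤ n) → TypesComputable (2 * n + 3) Φ := by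
  induction n with
  | zero =>
    intro Φ h
    refine (typesComputable_atoms fun ψ hψ => ?_).of_heads
    obtain ⟨φ, hφ, hψ⟩ := List.mem_flatMap.1 hψ
    exact φ.heads_of_md_eq_zero (Nat.le_zero.1 (h φ hφ)) ψ hψ
  | succ n ih =>
    intro Φ h
    refine (ih _ fun ψ hψ => ?_).of_heads
    obtain ⟨φ, hφ, hψ⟩ := List.mem_flatMap.1 hψ
    exact φ.heads_md n (h φ hφ) ψ hψ

theorem TypesComputable.exists_gnn {n : ℕ} {φ : KForm} (h : TypesComputable n [φ]) :
    ∃ N : GNN, N.L = n ∧ ∀ (G : PGraph) (u : G.V), φ.eval G u = true ↔ N.accepts G u := by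
  obtain ⟨T, _, _, τ, ⟨s, d, e, hs⟩, hdet⟩ := h
  obtain ⟨f, hf⟩ := hdet φ List.mem_cons_self
  let s' := Function.update s n ⟨d, 0, 0, 0⟩
  let a : ℕ → ℤ := fun i => if h : i < d then (if f (e.symm ⟨i, h⟩) then 1 else 0) else 0
  refine ⟨GNN.ofLayers s' n a, rfl, fun G u => ?_⟩
  have hdim : (s' n).dim = d := by simp [s']
  have hrun : Layer.run s' G n = Layer.run s G n :=
    Layer.run_congr G fun r hr => Function.update_of_ne hr.ne _ _
  have hsum : ∑ i, ((GNN.ofLayers s' n a).a i : ℝ) * (GNN.ofLayers s' n a).state G n u i =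
      if f (τ G u) then 1 else 0 := by
    calc _ = ∑ i : Fin (s' n).dim, (a i : ℝ) * Layer.run s' G n u i :=
          Finset.sum_congr rfl fun i _ => congrArg₂ _ rfl (GNN.state_ofLayers s' n a G n u i)
      _ = ∑ i : T, (a (e i) : ℝ) * Layer.run s G n u (e i) := by
          rw [← Finset.sum_range fun i => (a i : ℝ) * Layer.run s' G n u i, hdim, hrun,
            Finset.sum_range, ← e.sum_comp]
      _ = _ := by simp [hs, a]
  rw [hf]
  refine Iff.trans ?_ (iff_of_eq (congrArg (fun x : ℝ => 1 ≤ x) hsum.symm))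
  cases f (τ G u) <;> simp

/-- There is a constant c such that every K^# formula φ is equivalent
to a GNN with at most c·(md(φ)+1) layers. -/
theorem from_logic_to_GNN_few_layers :
    ∃ c : ℕ, ∀ φ : KForm, ∃ N : GNN, N.L ≤ c * (φ.md + 1) ∧
      ∀ (G : PGraph) (u : G.V), φ.eval G u = true ↔ N.accepts G u := by
  refine ⟨3, fun φ => ?_⟩
  obtain ⟨N, hL, hN⟩ := (typesComputable_of_md_le φ.md [φ] (by simp)).exists_gnn
  exact ⟨N, by omega, hN⟩
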